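/- The construction L ↦ ⟨L⟩, sending a set L of labels to the one-vertex asynchronous graph with an edge ℓ : ∗ → ∗ for each ℓ ∈ L and a permutation square ℓ₁·ℓ₂ ◇ ℓ₂·ℓ₁ for every pair of labels, defines a functor Set → Asynch, and for all sets L₁, L₂ there is a natural isomorphism ⟨L₁⟩ ⧢ ⟨L₂⟩ ≅ ⟨L₁ + L₂⟩ in Asynch, making ⟨−⟩ a symmetric monoidal functor from (Set,+,∅) to (Asynch,⧢,I). -/

import Mathlib

/-! Asynchronous graphs: graphs equipped with a set of permutation squares
satisfying symmetry, determinism and the cube property. -/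

/-- A graph together with a relation `Sq` on length-2 paths ("squares"):
`Sq (u₁, u₂) (v₁, v₂)` means that the square `u₁·u₂ ◇ v₁·v₂` is a permutation square. -/
structure PreAsync where
  V : Type
  E : Type
  src : E → V
  tgt : E → V
  Sq : (E × E) → (E × E) → Prop

namespace PreAsync

/-- Permutation squares only relate composable length-2 paths with the same endpoints. -/
def WellFormed (G : PreAsync) : Prop :=
  ∀ p q, G.Sq p q →
    G.tgt p.1 = G.src p.2 ∧ G.tgt q.1 = G.src q.2 ∧
    G.src p.1 = G.src q.1 ∧ G.tgt p.2 = G.tgt q.2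

/-- Every permutation square is symmetric. -/
def SqSymm (G : PreAsync) : Prop := ∀ p q, G.Sq p q → G.Sq q p

/-- Every permutation square is deterministic. -/
def SqDet (G : PreAsync) : Prop := ∀ p q q', G.Sq p q → G.Sq p q' → q = q'

/-- The cube property. -/
def Cube (G : PreAsync) : Prop :=
  ∀ u1 u2 u3 v1 v2 v3 : G.E,
    G.tgt u1 = G.src u2 → G.tgt u2 = G.src u3 →
    G.tgt v1 = G.src v2 → G.tgt v2 = G.src v3 →
    G.src u1 = G.src v1 → G.tgt u3 = G.tgt v3 →
    ((∃ w3 u2' v2', G.Sq (u2, u3) (u2', w3) ∧ G.Sq (u1, u2') (v1, v2') ∧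
        G.Sq (v2', w3) (v2, v3)) ↔
      (∃ w1 u2'' v2'', G.Sq (u1, u2) (w1, u2'') ∧ G.Sq (u2'', u3) (v2'', v3) ∧
        G.Sq (w1, v2'') (v1, v2)))

/-- An asynchronous graph. -/
def IsAsync (G : PreAsync) : Prop := G.WellFormed ∧ G.SqSymm ∧ G.SqDet ∧ G.Cube

end PreAsync

/-- An asynchronous graph homomorphism: a graph homomorphism transporting
permutation squares to permutation squares. -/
structure AsyncHom (G H : PreAsync) where
  vmap : G.V → H.V
  emap : G.E → H.E
  src_map : ∀ e, H.src (emap e) = vmap (G.src e)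
  tgt_map : ∀ e, H.tgt (emap e) = vmap (G.tgt e)
  sq_map : ∀ p q, G.Sq p q → H.Sq (emap p.1, emap p.2) (emap q.1, emap q.2)

namespace AsyncHom

def id (G : PreAsync) : AsyncHom G G :=
  ⟨fun x => x, fun e => e, fun _ => rfl, fun _ => rfl, fun p q h => h⟩

def comp {G H K : PreAsync} (f : AsyncHom G H) (g : AsyncHom H K) : AsyncHom G K where
  vmap := g.vmap ∘ f.vmap
  emap := g.emap ∘ f.emap
  src_map := fun e => by
    simp only [Function.comp_apply, g.src_map, f.src_map]
  tgt_map := fun e => by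
    simp only [Function.comp_apply, g.tgt_map, f.tgt_map]
  sq_map := fun p q h => g.sq_map _ _ (f.sq_map _ _ h)

end AsyncHom
abbrev ShuffleE (G H : PreAsync) : Type := Sum (G.E × H.V) (G.V × H.E)

/-- The permutation squares of the shuffle tensor product: independence squares
between moves in different components (in both directions), and squares
inherited from `G` and from `H`. -/
inductive ShuffleSq (G H : PreAsync) :
    (ShuffleE G H × ShuffleE G H) → (ShuffleE G H × ShuffleE G H) → Prop
  | commLR (u : G.E) (v : H.E) :
      ShuffleSq G H (Sum.inl (u, H.src v), Sum.inr (G.tgt u, v))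
        (Sum.inr (G.src u, v), Sum.inl (u, H.tgt v))
  | commRL (u : G.E) (v : H.E) :
      ShuffleSq G H (Sum.inr (G.src u, v), Sum.inl (u, H.tgt v))
        (Sum.inl (u, H.src v), Sum.inr (G.tgt u, v))
  | left {u1 u2 v1 v2 : G.E} (y : H.V) :
      G.Sq (u1, u2) (v1, v2) →
      ShuffleSq G H (Sum.inl (u1, y), Sum.inl (u2, y))
        (Sum.inl (v1, y), Sum.inl (v2, y))
  | right (x : G.V) {u1 u2 v1 v2 : H.E} :
      H.Sq (u1, u2) (v1, v2) →
      ShuffleSq G H (Sum.inr (x, u1), Sum.inr (x, u2))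
        (Sum.inr (x, v1), Sum.inr (x, v2))

/-- The shuffle tensor product of two pre-asynchronous graphs. -/
def PreAsync.shuffle (G H : PreAsync) : PreAsync where
  V := G.V × H.V
  E := ShuffleE G H
  src e := match e with
    | Sum.inl (u, y) => (G.src u, y)
    | Sum.inr (x, v) => (x, H.src v)
  tgt e := match e with
    | Sum.inl (u, y) => (G.tgt u, y)
    | Sum.inr (x, v) => (x, H.tgt v)
  Sq := ShuffleSq G H

/-- The unit of the shuffle tensor product: one vertex, no edges. -/
def unitAsync : PreAsync where
  V := Unit
  E := Empty
  src e := e.elim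
  tgt e := e.elim
  Sq p _ := p.1.elim

open CategoryTheory

/-- The category `Asynch` of asynchronous graphs and asynchronous graph
homomorphisms. -/
structure Asynch where
  G : PreAsync
  isAsync : G.IsAsync

instance : Category Asynch where
  Hom A B := AsyncHom A.G B.G
  id A := AsyncHom.id A.G
  comp f g := f.comp g
  id_comp := by intros; rfl
  comp_id := by intros; rfl
  assoc := by intros; rfl

/-- The one-vertex asynchronous graph `⟨L⟩` on a set `L` of labels: one vertex,
one self-loop for each label, and the permutation square `ℓ₁·ℓ₂ ◇ ℓ₂·ℓ₁` for
every pair of labels. -/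
def anchorOf (L : Type) : PreAsync where
  V := Unit
  E := L
  src _ := ()
  tgt _ := ()
  Sq p q := q.1 = p.2 ∧ q.2 = p.1

theorem PreAsync.isAsync_unit : unitAsync.IsAsync :=
  ⟨fun p => p.1.elim, fun p => p.1.elim, fun p => p.1.elim, fun u => u.elim⟩

theorem PreAsync.isAsync_anchorOf (L : Type) : (anchorOf L).IsAsync := by
  refine ⟨fun _ _ _ => ⟨rfl, rfl, rfl, rfl⟩, fun _ _ h => ⟨h.2.symm, h.1.symm⟩,
    fun _ _ _ h h' => Prod.ext (h.1.trans h'.1.symm) (h.2.trans h'.2.symm), ?_⟩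
  intro u1 u2 u3 v1 v2 v3 _ _ _ _ _ _
  constructor
  · rintro ⟨_, _, _, ⟨rfl, rfl⟩, ⟨rfl, rfl⟩, ⟨rfl, rfl⟩⟩
    exact ⟨_, _, _, ⟨rfl, rfl⟩, ⟨rfl, rfl⟩, ⟨rfl, rfl⟩⟩
  · rintro ⟨_, _, _, ⟨rfl, rfl⟩, ⟨rfl, rfl⟩, ⟨rfl, rfl⟩⟩
    exact ⟨_, _, _, ⟨rfl, rfl⟩, ⟨rfl, rfl⟩, ⟨rfl, rfl⟩⟩

namespace ShuffleSq

variable {G H : PreAsync}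

/-- The permutation squares of the shuffle tensor product, described by cases on the
component each edge belongs to. -/
theorem iff_match {a b c d : ShuffleE G H} :
    ShuffleSq G H (a, b) (c, d) ↔
      match a, b, c, d with
      | .inl (u, y), .inr (x, v), .inr (x', v'), .inl (u', y') =>
        u' = u ∧ v' = v ∧ y = H.src v ∧ x = G.tgt u ∧ x' = G.src u ∧ y' = H.tgt v
      | .inr (x', v'), .inl (u', y'), .inl (u, y), .inr (x, v) =>
        u' = u ∧ v' = v ∧ y = H.src v ∧ x = G.tgt u ∧ x' = G.src u ∧ y' = H.tgt v
      | .inl (u1, y1), .inl (u2, y2), .inl (v1, y3), .inl (v2, y4) =>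
        y2 = y1 ∧ y3 = y1 ∧ y4 = y1 ∧ G.Sq (u1, u2) (v1, v2)
      | .inr (x1, u1), .inr (x2, u2), .inr (x3, v1), .inr (x4, v2) =>
        x2 = x1 ∧ x3 = x1 ∧ x4 = x1 ∧ H.Sq (u1, u2) (v1, v2)
      | _, _, _, _ => False := by
  constructor
  · intro h
    cases h <;> simp_all
  · rcases a with ⟨a, a'⟩ | ⟨a, a'⟩ <;> rcases b with ⟨b, b'⟩ | ⟨b, b'⟩ <;>
      rcases c with ⟨c, c'⟩ | ⟨c, c'⟩ <;> rcases d with ⟨d, d'⟩ | ⟨d, d'⟩ <;>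
      simp only [false_imp_iff]
    · rintro ⟨rfl, rfl, rfl, h⟩
      exact .left _ h
    · rintro ⟨rfl, rfl, rfl, rfl, rfl, rfl⟩
      exact .commLR _ _
    · rintro ⟨rfl, rfl, rfl, rfl, rfl, rfl⟩
      exact .commRL _ _
    · rintro ⟨rfl, rfl, rfl, h⟩
      exact .right _ h

end ShuffleSq

theorem PreAsync.SqSymm.shuffle {G H : PreAsync} (hG : G.SqSymm) (hH : H.SqSymm) :
    (G.shuffle H).SqSymm := by
  intro p q h
  cases h with
  | commLR u v => exact .commRL u v
  | commRL u v => exact .commLR u v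
  | left y h => exact .left y (hG _ _ h)
  | right x h => exact .right x (hH _ _ h)

theorem PreAsync.WellFormed.shuffle {G H : PreAsync} (hG : G.WellFormed) (hH : H.WellFormed) :
    (G.shuffle H).WellFormed := by
  intro p q h
  cases h with
  | commLR u v => simp [PreAsync.shuffle]
  | commRL u v => simp [PreAsync.shuffle]
  | left y h => simpa [PreAsync.shuffle] using hG _ _ h
  | right x h => simpa [PreAsync.shuffle] using hH _ _ h

theorem PreAsync.SqDet.shuffle {G H : PreAsync} (hG : G.SqDet) (hH : H.SqDet) :
    (G.shuffle H).SqDet := by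
  rintro ⟨a, b⟩ ⟨c, d⟩ ⟨c', d'⟩ h h'
  replace h := ShuffleSq.iff_match.1 h
  replace h' := ShuffleSq.iff_match.1 h'
  have hG' := fun a b c d c' d' => hG (a, b) (c, d) (c', d')
  have hH' := fun a b c d c' d' => hH (a, b) (c, d) (c', d')
  simp only [Prod.mk.injEq] at hG' hH'
  rcases a with ⟨a, a'⟩ | ⟨a, a'⟩ <;> rcases b with ⟨b, b'⟩ | ⟨b, b'⟩ <;>
    rcases c with ⟨c, x⟩ | ⟨c, x⟩ <;> rcases d with ⟨d, y⟩ | ⟨d, y⟩ <;>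
    simp only at h <;>
    rcases c' with ⟨c', x'⟩ | ⟨c', x'⟩ <;> rcases d' with ⟨d', y'⟩ | ⟨d', y'⟩ <;>
    simp only at h' <;> grind

set_option maxHeartbeats 1000000 in
theorem PreAsync.Cube.shuffle {G H : PreAsync} (hG : G.IsAsync) (hH : H.IsAsync) :
    (G.shuffle H).Cube := by
  obtain ⟨wG, -, -, cG⟩ := hG
  obtain ⟨wH, -, -, cH⟩ := hH
  have wG' := fun a b c d => wG (a, b) (c, d)
  have wH' := fun a b c d => wH (a, b) (c, d)
  simp only at wG' wH'
  intro u1 u2 u3 v1 v2 v3 e1 e2 e3 e4 e5 e6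
  clear e1 e2 e3 e4 e5 e6
  change ShuffleE G H at u1 u2 u3 v1 v2 v3
  change (∃ w3 u2' v2' : ShuffleE G H, ShuffleSq G H (u2, u3) (u2', w3) ∧
      ShuffleSq G H (u1, u2') (v1, v2') ∧ ShuffleSq G H (v2', w3) (v2, v3)) ↔
    (∃ w1 u2'' v2'' : ShuffleE G H, ShuffleSq G H (u1, u2) (w1, u2'') ∧
      ShuffleSq G H (u2'', u3) (v2'', v3) ∧ ShuffleSq G H (w1, v2'') (v1, v2))
  constructor
  · rintro ⟨a, b, c, h1, h2, h3⟩
    rw [ShuffleSq.iff_match] at h1 h2 h3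
    rcases u2 with ⟨u2, x2⟩ | ⟨x2, u2⟩ <;> rcases u3 with ⟨u3, x3⟩ | ⟨x3, u3⟩ <;>
      rcases a with ⟨a, xa⟩ | ⟨xa, a⟩ <;> rcases b with ⟨b, xb⟩ | ⟨xb, b⟩ <;>
      simp only at h1 <;>
      rcases u1 with ⟨u1, x1⟩ | ⟨x1, u1⟩ <;> rcases v1 with ⟨v1, y1⟩ | ⟨y1, v1⟩ <;>
      rcases c with ⟨c, xc⟩ | ⟨xc, c⟩ <;> simp only at h2 <;>
      rcases v2 with ⟨v2, y2⟩ | ⟨y2, v2⟩ <;> rcases v3 with ⟨v3, y3⟩ | ⟨y3, v3⟩ <;>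
      simp only at h3
    · obtain ⟨p, q, r, k1, k2, k3⟩ := (cG u1 u2 u3 v1 v2 v3 (by grind) (by grind) (by grind)
        (by grind) (by grind) (by grind)).1 ⟨a, b, c, h1.2.2.2, h2.2.2.2, h3.2.2.2⟩
      refine ⟨.inl (p, x1), .inl (q, x1), .inl (r, x1), ?_⟩
      simp only [ShuffleSq.iff_match]
      grind
    · refine ⟨.inl (u2, H.src u1), .inr (G.tgt u2, u1), .inl (u3, H.src u1), ?_⟩
      simp only [ShuffleSq.iff_match]
      grind
    · refine ⟨.inl (v2, x1), .inl (v3, x1), .inr (G.src v3, u3), ?_⟩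
      simp only [ShuffleSq.iff_match]
      grind
    · refine ⟨.inl (u2, H.src u1), .inr (G.tgt u2, u1), .inr (G.tgt u2, v1), ?_⟩
      simp only [ShuffleSq.iff_match]
      grind
    · refine ⟨.inr (G.src u1, u2), .inl (u1, H.tgt u2), .inl (v1, H.tgt u2), ?_⟩
      simp only [ShuffleSq.iff_match]
      grind
    · refine ⟨.inr (x1, v2), .inr (x1, v3), .inl (u3, H.src v3), ?_⟩
      simp only [ShuffleSq.iff_match]
      grind
    · refine ⟨.inr (G.src u1, u2), .inl (u1, H.tgt u2), .inr (G.src u1, u3), ?_⟩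
      simp only [ShuffleSq.iff_match]
      grind
    · obtain ⟨p, q, r, k1, k2, k3⟩ := (cH u1 u2 u3 v1 v2 v3 (by grind) (by grind) (by grind)
        (by grind) (by grind) (by grind)).1 ⟨a, b, c, h1.2.2.2, h2.2.2.2, h3.2.2.2⟩
      refine ⟨.inr (x1, p), .inr (x1, q), .inr (x1, r), ?_⟩
      simp only [ShuffleSq.iff_match]
      grind
  · rintro ⟨a, b, c, h1, h2, h3⟩
    rw [ShuffleSq.iff_match] at h1 h2 h3
    rcases u1 with ⟨u1, x1⟩ | ⟨x1, u1⟩ <;> rcases u2 with ⟨u2, x2⟩ | ⟨x2, u2⟩ <;>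
      rcases a with ⟨a, xa⟩ | ⟨xa, a⟩ <;> rcases b with ⟨b, xb⟩ | ⟨xb, b⟩ <;>
      simp only at h1 <;>
      rcases u3 with ⟨u3, x3⟩ | ⟨x3, u3⟩ <;> rcases c with ⟨c, xc⟩ | ⟨xc, c⟩ <;>
      rcases v3 with ⟨v3, y3⟩ | ⟨y3, v3⟩ <;> simp only at h2 <;>
      rcases v1 with ⟨v1, y1⟩ | ⟨y1, v1⟩ <;> rcases v2 with ⟨v2, y2⟩ | ⟨y2, v2⟩ <;>
      simp only at h3
    · obtain ⟨p, q, r, k1, k2, k3⟩ := (cG u1 u2 u3 v1 v2 v3 (by grind) (by grind) (by grind)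
        (by grind) (by grind) (by grind)).2 ⟨a, b, c, h1.2.2.2, h2.2.2.2, h3.2.2.2⟩
      refine ⟨.inl (p, x1), .inl (q, x1), .inl (r, x1), ?_⟩
      simp only [ShuffleSq.iff_match]
      grind
    · refine ⟨.inl (u2, H.tgt u3), .inr (G.src u2, u3), .inl (u1, H.tgt u3), ?_⟩
      simp only [ShuffleSq.iff_match]
      grind
    · refine ⟨.inr (G.tgt u3, u2), .inl (u3, H.src u2), .inl (v3, H.src u2), ?_⟩
      simp only [ShuffleSq.iff_match]
      grind
    · refine ⟨.inr (G.tgt u1, v2), .inr (G.tgt u1, v1), .inl (u1, H.src v2), ?_⟩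
      simp only [ShuffleSq.iff_match]
      grind
    · refine ⟨.inl (v2, H.tgt u1), .inl (v1, H.tgt u1), .inr (G.src v2, u1), ?_⟩
      simp only [ShuffleSq.iff_match]
      grind
    · refine ⟨.inl (u2, H.tgt u3), .inr (G.src u2, u3), .inr (G.src u2, v3), ?_⟩
      simp only [ShuffleSq.iff_match]
      grind
    · refine ⟨.inr (G.tgt u3, u2), .inl (u3, H.src u2), .inr (G.tgt u3, u1), ?_⟩
      simp only [ShuffleSq.iff_match]
      grind
    · obtain ⟨p, q, r, k1, k2, k3⟩ := (cH u1 u2 u3 v1 v2 v3 (by grind) (by grind) (by grind)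
        (by grind) (by grind) (by grind)).2 ⟨a, b, c, h1.2.2.2, h2.2.2.2, h3.2.2.2⟩
      refine ⟨.inr (x1, p), .inr (x1, q), .inr (x1, r), ?_⟩
      simp only [ShuffleSq.iff_match]
      grind

theorem PreAsync.IsAsync.shuffle {G H : PreAsync} (hG : G.IsAsync) (hH : H.IsAsync) :
    (G.shuffle H).IsAsync :=
  ⟨hG.1.shuffle hH.1, hG.2.1.shuffle hH.2.1, hG.2.2.1.shuffle hH.2.2.1, .shuffle hG hH⟩

namespace AsyncHom

/-- The shuffle tensor product of two homomorphisms. -/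
def shuffleMap {G G' H H' : PreAsync} (f : AsyncHom G G') (g : AsyncHom H H') :
    AsyncHom (G.shuffle H) (G'.shuffle H') where
  vmap := Prod.map f.vmap g.vmap
  emap := Sum.map (Prod.map f.emap g.vmap) (Prod.map f.vmap g.emap)
  src_map := by
    rintro (⟨u, y⟩ | ⟨x, v⟩)
    · exact Prod.ext (f.src_map u) rfl
    · exact Prod.ext rfl (g.src_map v)
  tgt_map := by
    rintro (⟨u, y⟩ | ⟨x, v⟩)
    · exact Prod.ext (f.tgt_map u) rfl
    · exact Prod.ext rfl (g.tgt_map v)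
  sq_map := by
    rintro _ _ (⟨u, v⟩ | ⟨u, v⟩ | ⟨y, h⟩ | ⟨x, h⟩)
    · have h := ShuffleSq.commLR (f.emap u) (g.emap v)
      rwa [f.src_map, f.tgt_map, g.src_map, g.tgt_map] at h
    · have h := ShuffleSq.commRL (f.emap u) (g.emap v)
      rwa [f.src_map, f.tgt_map, g.src_map, g.tgt_map] at h
    · exact .left _ (f.sq_map _ _ h)
    · exact .right _ (g.sq_map _ _ h)

/-- The symmetry of the shuffle tensor product. -/
def shuffleSwap (G H : PreAsync) : AsyncHom (G.shuffle H) (H.shuffle G) where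
  vmap := Prod.swap
  emap
    | .inl (u, y) => .inr (y, u)
    | .inr (x, v) => .inl (v, x)
  src_map := by rintro (_ | _) <;> rfl
  tgt_map := by rintro (_ | _) <;> rfl
  sq_map := by
    rintro _ _ (⟨u, v⟩ | ⟨u, v⟩ | ⟨y, h⟩ | ⟨x, h⟩)
    · exact .commRL v u
    · exact .commLR v u
    · exact .right y h
    · exact .left x h

/-- The associator of the shuffle tensor product. -/
def shuffleAssoc (G H K : PreAsync) :
    AsyncHom ((G.shuffle H).shuffle K) (G.shuffle (H.shuffle K)) where
  vmap := fun ((x, y), z) => (x, (y, z))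
  emap
    | .inl (.inl (u, y), z) => .inl (u, (y, z))
    | .inl (.inr (x, v), z) => .inr (x, .inl (v, z))
    | .inr ((x, y), w) => .inr (x, .inr (y, w))
  src_map := by rintro (⟨_ | _, _⟩ | _) <;> rfl
  tgt_map := by rintro (⟨_ | _, _⟩ | _) <;> rfl
  sq_map := by
    rintro _ _ (⟨u | v, w⟩ | ⟨u | v, w⟩ | ⟨z, ⟨u, v⟩ | ⟨u, v⟩ | ⟨y, h⟩ | ⟨x, h⟩⟩ | ⟨x, h⟩)
    · exact .commLR (G := G) (H := H.shuffle K) u.1 (.inr (u.2, w))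
    · exact .right v.1 (.commLR v.2 w)
    · exact .commRL (G := G) (H := H.shuffle K) u.1 (.inr (u.2, w))
    · exact .right v.1 (.commRL v.2 w)
    · exact .commLR (G := G) (H := H.shuffle K) u (.inl (v, z))
    · exact .commRL (G := G) (H := H.shuffle K) u (.inl (v, z))
    · exact .left _ h
    · exact .right x (.left z h)
    · exact .right x.1 (.right x.2 h)

/-- The inverse of the associator of the shuffle tensor product. -/
def shuffleAssocInv (G H K : PreAsync) :
    AsyncHom (G.shuffle (H.shuffle K)) ((G.shuffle H).shuffle K) where
  vmap := fun (x, (y, z)) => ((x, y), z)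
  emap
    | .inl (u, (y, z)) => .inl (.inl (u, y), z)
    | .inr (x, .inl (v, z)) => .inl (.inr (x, v), z)
    | .inr (x, .inr (y, w)) => .inr ((x, y), w)
  src_map := by rintro (_ | ⟨_, _ | _⟩) <;> rfl
  tgt_map := by rintro (_ | ⟨_, _ | _⟩) <;> rfl
  sq_map := by
    rintro _ _ (⟨u, v | w⟩ | ⟨u, v | w⟩ | ⟨y, h⟩ | ⟨x, ⟨u, v⟩ | ⟨u, v⟩ | ⟨y, h⟩ | ⟨y, h⟩⟩)
    · exact .left v.2 (.commLR u v.1)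
    · exact .commLR (G := G.shuffle H) (H := K) (.inl (u, w.1)) w.2
    · exact .left v.2 (.commRL u v.1)
    · exact .commRL (G := G.shuffle H) (H := K) (.inl (u, w.1)) w.2
    · exact .left y.2 (.left y.1 h)
    · exact .commLR (G := G.shuffle H) (H := K) (.inr (x, u)) v
    · exact .commRL (G := G.shuffle H) (H := K) (.inr (x, u)) v
    · exact .left y (.right x h)
    · exact .right _ h

/-- The left unitor of the shuffle tensor product. -/
def shuffleUnitLeft (G : PreAsync) : AsyncHom (unitAsync.shuffle G) G where
  vmap := Prod.snd
  emap
    | .inl (u, _) => u.elim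
    | .inr (_, v) => v
  src_map := by rintro (⟨⟨⟩, _⟩ | _); rfl
  tgt_map := by rintro (⟨⟨⟩, _⟩ | _); rfl
  sq_map := by
    intro p q h
    cases h with
    | commLR u _ => exact Empty.elim u
    | commRL u _ => exact Empty.elim u
    | @left u => exact Empty.elim u
    | right _ h => exact h

/-- The inverse of the left unitor of the shuffle tensor product. -/
def shuffleUnitLeftInv (G : PreAsync) : AsyncHom G (unitAsync.shuffle G) where
  vmap y := ((), y)
  emap v := .inr ((), v)
  src_map _ := rfl
  tgt_map _ := rfl
  sq_map _ _ h := .right (G := unitAsync) () h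

/-- The homomorphism `⟨L₁⟩ ⟶ ⟨L₂⟩` induced by a map of labels. -/
def anchorMap {L₁ L₂ : Type} (f : L₁ → L₂) : AsyncHom (anchorOf L₁) (anchorOf L₂) where
  vmap := _root_.id
  emap := f
  src_map _ := rfl
  tgt_map _ := rfl
  sq_map _ _ h := ⟨congrArg f h.1, congrArg f h.2⟩

/-- The comparison `⟨L₁⟩ ⧢ ⟨L₂⟩ ⟶ ⟨L₁ + L₂⟩`. -/
def anchorSum (L₁ L₂ : Type) :
    AsyncHom ((anchorOf L₁).shuffle (anchorOf L₂)) (anchorOf (L₁ ⊕ L₂)) where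
  vmap _ := ()
  emap
    | .inl (a, _) => .inl a
    | .inr (_, b) => .inr b
  src_map _ := rfl
  tgt_map _ := rfl
  sq_map := by
    rintro _ _ (⟨_, _⟩ | ⟨_, _⟩ | ⟨_, h⟩ | ⟨_, h⟩)
    · exact ⟨rfl, rfl⟩
    · exact ⟨rfl, rfl⟩
    · exact ⟨congrArg _ h.1, congrArg _ h.2⟩
    · exact ⟨congrArg _ h.1, congrArg _ h.2⟩

/-- The inverse comparison `⟨L₁ + L₂⟩ ⟶ ⟨L₁⟩ ⧢ ⟨L₂⟩`. -/
def anchorSumInv (L₁ L₂ : Type) :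
    AsyncHom (anchorOf (L₁ ⊕ L₂)) ((anchorOf L₁).shuffle (anchorOf L₂)) where
  vmap _ := ((), ())
  emap
    | .inl a => .inl (a, ())
    | .inr b => .inr ((), b)
  src_map := by rintro (_ | _) <;> rfl
  tgt_map := by rintro (_ | _) <;> rfl
  sq_map := by
    rintro ⟨a | a, b | b⟩ ⟨_, _⟩ ⟨rfl, rfl⟩
    · exact .left (G := anchorOf L₁) (H := anchorOf L₂) () ⟨rfl, rfl⟩
    · exact .commLR (G := anchorOf L₁) (H := anchorOf L₂) a b
    · exact .commRL (G := anchorOf L₁) (H := anchorOf L₂) b a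
    · exact .right (G := anchorOf L₁) (H := anchorOf L₂) () ⟨rfl, rfl⟩

/-- The comparison `I ⟶ ⟨∅⟩`. -/
def anchorEmpty : AsyncHom unitAsync (anchorOf Empty) where
  vmap := _root_.id
  emap := _root_.id
  src_map e := e.elim
  tgt_map e := e.elim
  sq_map p := p.1.elim

/-- The inverse comparison `⟨∅⟩ ⟶ I`. -/
def anchorEmptyInv : AsyncHom (anchorOf Empty) unitAsync where
  vmap := _root_.id
  emap := _root_.id
  src_map e := e.elim
  tgt_map e := e.elim
  sq_map p := p.1.elim

end AsyncHom

namespace Asynch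

open AsyncHom

theorem hom_ext {A B : Asynch} {f g : A ⟶ B} (hv : ∀ x, AsyncHom.vmap f x = AsyncHom.vmap g x)
    (he : ∀ e, AsyncHom.emap f e = AsyncHom.emap g e) : f = g := by
  obtain ⟨_, _, _, _, _⟩ := f
  obtain ⟨_, _, _, _, _⟩ := g
  obtain rfl := funext hv
  obtain rfl := funext he
  rfl

instance : MonoidalCategoryStruct Asynch where
  tensorObj A B := ⟨A.G.shuffle B.G, A.isAsync.shuffle B.isAsync⟩
  whiskerLeft A _ _ f := shuffleMap (AsyncHom.id A.G) f
  whiskerRight f B := shuffleMap f (AsyncHom.id B.G)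
  tensorHom f g := shuffleMap f g
  tensorUnit := ⟨unitAsync, PreAsync.isAsync_unit⟩
  associator A B C :=
    { hom := shuffleAssoc A.G B.G C.G
      inv := shuffleAssocInv A.G B.G C.G
      hom_inv_id := hom_ext (fun _ => rfl) (by rintro (⟨_ | _, _⟩ | _) <;> rfl)
      inv_hom_id := hom_ext (fun _ => rfl) (by rintro (_ | ⟨_, _ | _⟩) <;> rfl) }
  leftUnitor A :=
    { hom := shuffleUnitLeft A.G
      inv := shuffleUnitLeftInv A.G
      hom_inv_id := hom_ext (fun _ => rfl) (by rintro (⟨⟨⟩, _⟩ | _); rfl)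
      inv_hom_id := rfl }
  rightUnitor A :=
    { hom := (shuffleSwap A.G unitAsync).comp (shuffleUnitLeft A.G)
      inv := (shuffleUnitLeftInv A.G).comp (shuffleSwap unitAsync A.G)
      hom_inv_id := hom_ext (fun _ => rfl) (by rintro (_ | ⟨_, ⟨⟩⟩); rfl)
      inv_hom_id := rfl }

/-- The shuffle tensor product makes `Asynch` a monoidal category. -/
instance : MonoidalCategory Asynch where
  tensorHom_def _ _ := hom_ext (fun _ => rfl) (by rintro (_ | _) <;> rfl)
  id_tensorHom_id _ _ := hom_ext (fun _ => rfl) (by rintro (_ | _) <;> rfl)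
  tensorHom_comp_tensorHom _ _ _ _ := hom_ext (fun _ => rfl) (by rintro (_ | _) <;> rfl)
  whiskerLeft_id _ _ := hom_ext (fun _ => rfl) (by rintro (_ | _) <;> rfl)
  id_whiskerRight _ _ := hom_ext (fun _ => rfl) (by rintro (_ | _) <;> rfl)
  associator_naturality _ _ _ :=
    hom_ext (fun _ => rfl) (by rintro (⟨_ | _, _⟩ | _) <;> rfl)
  leftUnitor_naturality _ := hom_ext (fun _ => rfl) (by rintro (⟨⟨⟩, _⟩ | _); rfl)
  rightUnitor_naturality _ := hom_ext (fun _ => rfl) (by rintro (_ | ⟨_, ⟨⟩⟩); rfl)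
  pentagon _ _ _ _ :=
    hom_ext (fun _ => rfl) (by rintro (⟨⟨_ | _, _⟩ | _, _⟩ | _) <;> rfl)
  triangle _ _ := hom_ext (fun _ => rfl) (by rintro (⟨_ | ⟨_, ⟨⟩⟩, _⟩ | _) <;> rfl)

/-- The shuffle tensor product is symmetric. -/
instance : SymmetricCategory Asynch where
  braiding A B :=
    { hom := shuffleSwap A.G B.G
      inv := shuffleSwap B.G A.G
      hom_inv_id := hom_ext (fun _ => rfl) (by rintro (_ | _) <;> rfl)
      inv_hom_id := hom_ext (fun _ => rfl) (by rintro (_ | _) <;> rfl) }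
  braiding_naturality_right _ _ _ _ := hom_ext (fun _ => rfl) (by rintro (_ | _) <;> rfl)
  braiding_naturality_left _ _ := hom_ext (fun _ => rfl) (by rintro (_ | _) <;> rfl)
  hexagon_forward _ _ _ := hom_ext (fun _ => rfl) (by rintro (⟨_ | _, _⟩ | _) <;> rfl)
  hexagon_reverse _ _ _ := hom_ext (fun _ => rfl) (by rintro (_ | ⟨_, _ | _⟩) <;> rfl)
  symmetry _ _ := hom_ext (fun _ => rfl) (by rintro (_ | _) <;> rfl)

end Asynch

/-- The monoidal structure on `Type` given by disjoint unions. -/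
@[reducible]
def sumMonoidalCategory : MonoidalCategory Type where
  tensorObj L₁ L₂ := L₁ ⊕ L₂
  whiskerLeft _ _ _ f := ↾(Sum.map id f)
  whiskerRight f _ := ↾(Sum.map f id)
  tensorHom f g := ↾(Sum.map f g)
  tensorUnit := Empty
  associator L₁ L₂ L₃ := (Equiv.sumAssoc L₁ L₂ L₃).toIso
  leftUnitor L := (Equiv.emptySum Empty L).toIso
  rightUnitor L := (Equiv.sumEmpty L Empty).toIso
  tensorHom_def _ _ := by ext (_ | _) <;> rfl
  id_tensorHom_id _ _ := by ext (_ | _) <;> rfl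
  tensorHom_comp_tensorHom _ _ _ _ := by ext (_ | _) <;> rfl
  whiskerLeft_id _ _ := by ext (_ | _) <;> rfl
  id_whiskerRight _ _ := by ext (_ | _) <;> rfl
  associator_naturality _ _ _ := by ext ((_ | _) | _) <;> rfl
  leftUnitor_naturality _ := by ext (⟨⟨⟩⟩ | _); rfl
  rightUnitor_naturality _ := by ext (_ | ⟨⟨⟩⟩); rfl
  pentagon _ _ _ _ := by ext (((_ | _) | _) | _) <;> rfl
  triangle _ _ := by ext ((_ | ⟨⟨⟩⟩) | _) <;> rfl

attribute [local instance] sumMonoidalCategory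

/-- Disjoint unions are a symmetric tensor product on `Type`. -/
@[reducible]
def sumSymmetricCategory : SymmetricCategory Type where
  braiding L₁ L₂ := (Equiv.sumComm L₁ L₂).toIso
  braiding_naturality_right _ _ _ _ := by ext (_ | _) <;> rfl
  braiding_naturality_left _ _ := by ext (_ | _) <;> rfl
  hexagon_forward _ _ _ := by ext ((_ | _) | _) <;> rfl
  hexagon_reverse _ _ _ := by ext (_ | (_ | _)) <;> rfl
  symmetry _ _ := by ext (_ | _) <;> rfl

attribute [local instance] sumSymmetricCategory

/-- The functor `L ↦ ⟨L⟩`. -/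
def anchorFunctor : Type ⥤ Asynch where
  obj L := ⟨anchorOf L, PreAsync.isAsync_anchorOf L⟩
  map f := AsyncHom.anchorMap f
  map_id _ := rfl
  map_comp _ _ := rfl

/-- The natural isomorphisms `I ≅ ⟨∅⟩` and `⟨L₁⟩ ⧢ ⟨L₂⟩ ≅ ⟨L₁ + L₂⟩`. -/
def anchorCoreMonoidal : anchorFunctor.CoreMonoidal where
  εIso :=
    { hom := AsyncHom.anchorEmpty
      inv := AsyncHom.anchorEmptyInv
      hom_inv_id := rfl
      inv_hom_id := rfl }
  μIso L₁ L₂ :=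
    { hom := AsyncHom.anchorSum L₁ L₂
      inv := AsyncHom.anchorSumInv L₁ L₂
      hom_inv_id := Asynch.hom_ext (fun _ => rfl) (by rintro (_ | _) <;> rfl)
      inv_hom_id := Asynch.hom_ext (fun _ => rfl) (by rintro (_ | _) <;> rfl) }
  μIso_hom_natural_left _ _ := Asynch.hom_ext (fun _ => rfl) (by rintro (_ | _) <;> rfl)
  μIso_hom_natural_right _ _ := Asynch.hom_ext (fun _ => rfl) (by rintro (_ | _) <;> rfl)
  associativity _ _ _ :=
    Asynch.hom_ext (fun _ => rfl) (by rintro (⟨_ | _, _⟩ | _) <;> rfl)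
  left_unitality _ := Asynch.hom_ext (fun _ => rfl) (by rintro (⟨⟨⟩, _⟩ | _); rfl)
  right_unitality _ := Asynch.hom_ext (fun _ => rfl) (by rintro (_ | ⟨_, ⟨⟩⟩); rfl)

/-- The functor `L ↦ ⟨L⟩` is symmetric monoidal. -/
@[reducible]
def anchorBraided : anchorFunctor.Braided where
  __ := anchorCoreMonoidal.toMonoidal
  braided _ _ := Asynch.hom_ext (fun _ => rfl) (by rintro (_ | _) <;> rfl)

/-- `L ↦ ⟨L⟩` defines a functor `Set → Asynch` which is symmetric
monoidal from `(Set, +, ∅)` to `(Asynch, ⧢, I)`; in particular its monoidal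
coercions give natural isomorphisms `⟨L₁⟩ ⧢ ⟨L₂⟩ ≅ ⟨L₁ + L₂⟩`. -/
theorem anchor_symmetric_monoidal_functor :
    ∃ (MT : MonoidalCategory Type)
      (MA : MonoidalCategory Asynch)
      (BT : @BraidedCategory Type _ MT)
      (BA : @BraidedCategory Asynch _ MA)
      (F : Type ⥤ Asynch),
      (∀ L1 L2 : Type,
        @MonoidalCategoryStruct.tensorObj Type _ MT.toMonoidalCategoryStruct L1 L2
          = Sum L1 L2) ∧
      (@MonoidalCategoryStruct.tensorUnit Type _ MT.toMonoidalCategoryStruct = Empty) ∧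
      (∀ A B : Asynch,
        (@MonoidalCategoryStruct.tensorObj Asynch _ MA.toMonoidalCategoryStruct A B).G
          = A.G.shuffle B.G) ∧
      ((@MonoidalCategoryStruct.tensorUnit Asynch _ MA.toMonoidalCategoryStruct).G
          = unitAsync) ∧
      (∀ L : Type, (F.obj L).G = anchorOf L) ∧
      Nonempty (@SymmetricCategory Type _ MT) ∧
      Nonempty (@SymmetricCategory Asynch _ MA) ∧
      Nonempty (@Functor.Braided Type _ MT BT Asynch _ MA BA F) := by
  exact ⟨sumMonoidalCategory, inferInstance, sumSymmetricCategory.toBraidedCategory,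
    inferInstance, anchorFunctor, fun _ _ => rfl, rfl, fun _ _ => rfl, rfl, fun _ => rfl,
    ⟨sumSymmetricCategory⟩, ⟨inferInstance⟩, ⟨anchorBraided⟩⟩
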